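/- (Kahane–Salem–Zygmund inequality, extended form) Let m ≥ 1 be an integer and p_1, …, p_m ∈ [1, ∞] be given, and for p ≥ 1 set α(p) = 1/2 − 1/p if p ≥ 2 and α(p) = 0 otherwise. Then there exists a constant C_m > 0 such that for every positive integer N there exist signs ε_{i_1,…,i_m} ∈ {−1, +1} (for 1 ≤ i_1, …, i_m ≤ N) for which the m-linear form A : ℓ_{p_1}^N × ⋯ × ℓ_{p_m}^N → 𝕂 defined by A(z^{(1)}, …, z^{(m)}) = ∑_{i_1,…,i_m=1}^N ε_{i_1,…,i_m} z^{(1)}_{i_1} ⋯ z^{(m)}_{i_m} satisfies ‖A‖ ≤ C_m · N^{1/2 + α(p_1) + ⋯ + α(p_m)}. -/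

import Mathlib

open scoped BigOperators ENNReal

/-- The `ℓ_p` norm on `𝕂^n` for `p ∈ [1, ∞]` (max norm when `p = ∞`). -/
noncomputable def lpNormE (𝕂 : Type*) [RCLike 𝕂] (p : ℝ≥0∞) {n : ℕ} (x : Fin n → 𝕂) : ℝ :=
  if p = ∞ then ⨆ i, ‖x i‖ else (∑ i, ‖x i‖ ^ p.toReal) ^ (1 / p.toReal)

/-- The sup norm of an `m`-linear form on `ℓ_{p 1}^n × ⋯ × ℓ_{p m}^n`. -/
noncomputable def multilinearNormE (𝕂 : Type*) [RCLike 𝕂] {m n : ℕ} (p : Fin m → ℝ≥0∞)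
    (T : MultilinearMap 𝕂 (fun _ : Fin m => Fin n → 𝕂) 𝕂) : ℝ :=
  sSup {t : ℝ | ∃ x : Fin m → Fin n → 𝕂, (∀ k, lpNormE 𝕂 (p k) (x k) ≤ 1) ∧ t = ‖T x‖}

/-- `α(p) = 1/2 - 1/p` if `p ≥ 2` (in particular `α(∞) = 1/2`), and `α(p) = 0` otherwise. -/
noncomputable def kszAlpha (p : ℝ≥0∞) : ℝ :=
  if 2 ≤ p then 1 / 2 - 1 / p.toReal else 0


theorem sum_units_exp_le (a : ℝ) :
    ∑ u : ℤˣ, Real.exp ((u : ℤ) * a) ≤ 2 * Real.exp (a ^ 2 / 2) := by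
  have h : ∑ u : ℤˣ, Real.exp ((u : ℤ) * a) = Real.exp a + Real.exp (-a) := by
    rw [UnitsInt.univ, Finset.sum_pair (by decide)]
    simp
  have := Real.cosh_le_exp_half_sq a
  rw [Real.cosh_eq] at this
  linarith

theorem sum_signs_exp_le {ι : Type*} [Fintype ι] [DecidableEq ι] (c : ι → ℝ)
    (hc : ∑ i, c i ^ 2 ≤ 1) (t : ℝ) :
    ∑ e : ι → ℤˣ, Real.exp (t * ∑ i, ((e i : ℤ) : ℝ) * c i)
      ≤ ∑ _e : ι → ℤˣ, Real.exp (t ^ 2 / 2) := by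
  calc ∑ e : ι → ℤˣ, Real.exp (t * ∑ i, ((e i : ℤ) : ℝ) * c i)
      = ∑ e : ι → ℤˣ, ∏ i, Real.exp (((e i : ℤ) : ℝ) * (t * c i)) := by
        refine Finset.sum_congr rfl fun e _ => ?_
        rw [← Real.exp_sum, Finset.mul_sum]
        congr 1
        exact Finset.sum_congr rfl fun i _ => by ring
    _ = ∏ i, ∑ u : ℤˣ, Real.exp (((u : ℤ) : ℝ) * (t * c i)) :=
        (Fintype.prod_sum (fun i (u : ℤˣ) => Real.exp (((u : ℤ) : ℝ) * (t * c i)))).symm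
    _ ≤ ∏ i, (2 * Real.exp ((t * c i) ^ 2 / 2)) :=
        Finset.prod_le_prod (fun i _ => by positivity) fun i _ => sum_units_exp_le _
    _ = 2 ^ Fintype.card ι * Real.exp (t ^ 2 / 2 * ∑ i, c i ^ 2) := by
        rw [Finset.prod_mul_distrib, ← Real.exp_sum, Finset.mul_sum]
        simp only [Finset.prod_const, Finset.card_univ]
        congr 2
        exact Finset.sum_congr rfl fun i _ => by ring
    _ ≤ 2 ^ Fintype.card ι * Real.exp (t ^ 2 / 2) := by
        gcongr
        exact mul_le_of_le_one_right (by positivity) hc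
    _ = ∑ _e : ι → ℤˣ, Real.exp (t ^ 2 / 2) := by simp

/-- Finitely many normalised Rademacher sums are simultaneously small for some choice of signs. -/
theorem exists_signs_forall_exp_le {ι κ : Type*} [Fintype ι] (S : Finset κ) (c : κ → ι → ℝ)
    (hc : ∀ j ∈ S, ∑ i, c j i ^ 2 ≤ 1) (t : ℝ) :
    ∃ e : ι → ℤˣ, ∀ j ∈ S,
      Real.exp (t * |∑ i, ((e i : ℤ) : ℝ) * c j i|) ≤ 2 * S.card * Real.exp (t ^ 2 / 2) := by
  classical
  let X : (ι → ℤˣ) → κ → ℝ := fun e j => ∑ i, ((e i : ℤ) : ℝ) * c j i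
  have hsum : ∑ e : ι → ℤˣ, ∑ j ∈ S, (Real.exp (t * X e j) + Real.exp (-t * X e j))
      ≤ ∑ _e : ι → ℤˣ, 2 * S.card * Real.exp (t ^ 2 / 2) := by
    rw [Finset.sum_comm]
    calc _ ≤ ∑ j ∈ S, ∑ _e : ι → ℤˣ, 2 * Real.exp (t ^ 2 / 2) := by
          refine Finset.sum_le_sum fun j hj => ?_
          have h1 := sum_signs_exp_le (c j) (hc j hj) t
          have h2 := sum_signs_exp_le (c j) (hc j hj) (-t)
          rw [neg_sq] at h2
          rw [Finset.sum_add_distrib, ← Finset.mul_sum, two_mul]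
          exact add_le_add h1 h2
      _ = _ := by
          rw [Finset.sum_comm]
          refine Finset.sum_congr rfl fun e _ => ?_
          rw [Finset.sum_const, nsmul_eq_mul]
          ring
  obtain ⟨e, -, he⟩ := Finset.exists_le_of_sum_le Finset.univ_nonempty hsum
  refine ⟨e, fun j hj => ?_⟩
  have hj' : Real.exp (t * X e j) + Real.exp (-t * X e j)
      ≤ 2 * S.card * Real.exp (t ^ 2 / 2) :=
    (Finset.single_le_sum (f := fun j => Real.exp (t * X e j) + Real.exp (-t * X e j))
      (fun j _ => by positivity) hj).trans he
  refine le_trans ?_ hj'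
  have p1 := Real.exp_pos (t * X e j)
  have p2 := Real.exp_pos (-t * X e j)
  change Real.exp (t * |X e j|) ≤ _
  rcases abs_cases (X e j) with ⟨h, -⟩ | ⟨h, -⟩ <;> rw [h]
  · linarith
  · rw [mul_neg, ← neg_mul]; linarith

theorem Int.exists_abs_le_abs_sub_le (x : ℝ) : ∃ k : ℤ, |(k : ℝ)| ≤ |x| ∧ |x - k| ≤ 1 := by
  rcases le_total 0 x with h | h
  · refine ⟨⌊x⌋, ?_, ?_⟩
    · rw [abs_of_nonneg h, abs_of_nonneg (by exact_mod_cast Int.floor_nonneg.2 h)]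
      exact Int.floor_le x
    · rw [abs_le]
      constructor <;> linarith [Int.floor_le x, Int.lt_floor_add_one x]
  · refine ⟨⌈x⌉, ?_, ?_⟩
    · rw [abs_of_nonpos h, abs_of_nonpos (by exact_mod_cast Int.ceil_nonpos.2 h)]
      linarith [Int.le_ceil x]
    · rw [abs_le]
      constructor <;> linarith [Int.le_ceil x, Int.ceil_lt_add_one x]

theorem summable_half_pow_natAbs : Summable fun j : ℤ => (1 / 2 : ℝ) ^ j.natAbs := by
  refine Summable.of_nat_of_neg ?_ ?_ <;> simpa using summable_geometric_two

/-- The number of integer points of an `ℓ₁`-ball of radius `R * N` in dimension `N` grows at most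
exponentially in `N`. -/
theorem exists_finset_int_points (R : ℕ) : ∃ K : ℝ, 1 ≤ K ∧ ∀ N : ℕ,
    ∃ F : Finset (Fin N → ℤ), (F.card : ℝ) ≤ K ^ N ∧
      ∀ a : Fin N → ℤ, ∑ i, (a i).natAbs ≤ R * N → a ∈ F := by
  let g : ℤ → ℝ := fun j => (1 / 2 : ℝ) ^ j.natAbs
  have hg : ∀ j, 0 ≤ g j := fun j => by positivity
  have hS : 1 ≤ ∑' j, g j := by
    simpa [g] using summable_half_pow_natAbs.le_tsum 0 (fun j _ => hg j)
  refine ⟨2 ^ R * ∑' j, g j, one_le_mul_of_one_le_of_one_le (one_le_pow₀ one_le_two) hS,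
    fun N => ?_⟩
  let B : Finset (Fin N → ℤ) := Fintype.piFinset fun _ => Finset.Icc (-(R * N : ℕ) : ℤ) (R * N : ℕ)
  refine ⟨B.filter fun a => ∑ i, (a i).natAbs ≤ R * N, ?_, fun a ha => ?_⟩
  · calc ((B.filter fun a => ∑ i, (a i).natAbs ≤ R * N).card : ℝ)
        = ∑ a ∈ B.filter fun a => ∑ i, (a i).natAbs ≤ R * N, (1 : ℝ) := by simp
      _ ≤ ∑ a ∈ B.filter fun a => ∑ i, (a i).natAbs ≤ R * N, 2 ^ (R * N) * ∏ i, g (a i) := by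
          refine Finset.sum_le_sum fun a ha => ?_
          have ha' := (Finset.mem_filter.1 ha).2
          simp only [g]
          rw [Finset.prod_pow_eq_pow_sum, one_div, inv_pow, ← div_eq_mul_inv,
            one_le_div (by positivity)]
          exact pow_le_pow_right₀ one_le_two ha'
      _ ≤ ∑ a ∈ B, 2 ^ (R * N) * ∏ i, g (a i) :=
          Finset.sum_le_sum_of_subset_of_nonneg (Finset.filter_subset _ _) fun a _ _ =>
            mul_nonneg (by positivity) (Finset.prod_nonneg fun i _ => hg _)
      _ = 2 ^ (R * N) * ∏ _i : Fin N, ∑ j ∈ Finset.Icc (-(R * N : ℕ) : ℤ) (R * N : ℕ), g j := by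
          rw [← Finset.mul_sum, Finset.prod_univ_sum]
      _ ≤ 2 ^ (R * N) * ∏ _i : Fin N, ∑' j, g j := by
          gcongr with i
          · exact summable_half_pow_natAbs.sum_le_tsum _ fun j _ => hg j
      _ = (2 ^ R * ∑' j, g j) ^ N := by
          rw [mul_pow, ← pow_mul]
          simp
  · refine Finset.mem_filter.2 ⟨Fintype.mem_piFinset.2 fun i => ?_, ha⟩
    have := (Finset.single_le_sum (f := fun i => (a i).natAbs) (fun _ _ => Nat.zero_le _)
      (Finset.mem_univ i)).trans ha
    rw [Finset.mem_Icc]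
    omega

theorem norm_I_le_one (𝕂 : Type*) [RCLike 𝕂] : ‖(RCLike.I : 𝕂)‖ ≤ 1 := by
  rcases eq_or_ne (RCLike.I : 𝕂) 0 with h | h
  · simp [h]
  · exact (RCLike.norm_I_of_ne_zero h).le

theorem norm_le_abs_re_add_abs_im {𝕂 : Type*} [RCLike 𝕂] (z : 𝕂) :
    ‖z‖ ≤ |RCLike.re z| + |RCLike.im z| := by
  conv_lhs => rw [← RCLike.re_add_im z]
  refine (norm_add_le _ _).trans ?_
  rw [norm_mul, RCLike.norm_ofReal, RCLike.norm_ofReal]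
  gcongr
  exact mul_le_of_le_one_right (abs_nonneg _) (norm_I_le_one 𝕂)

/-- The Euclidean unit ball of `𝕂^N` has a `2 / L`-net of cardinality exponential in `N`. -/
theorem exists_euclidean_net (𝕂 : Type*) [RCLike 𝕂] (L : ℕ) (hL : 0 < L) :
    ∃ K : ℝ, 1 ≤ K ∧ ∀ N : ℕ, 0 < N → ∃ Y : Finset (EuclideanSpace 𝕂 (Fin N)),
      (Y.card : ℝ) ≤ K ^ N ∧ (∀ y ∈ Y, ‖y‖ ≤ 1) ∧
        ∀ x : EuclideanSpace 𝕂 (Fin N), ‖x‖ ≤ 1 → ∃ y ∈ Y, ‖x - y‖ ≤ 2 / L := by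
  classical
  obtain ⟨K, hK, H⟩ := exists_finset_int_points (L ^ 2)
  refine ⟨K ^ 2, one_le_pow₀ hK, fun N hN => ?_⟩
  obtain ⟨F, hFcard, hF⟩ := H N
  have hNr : (0 : ℝ) < N := by exact_mod_cast hN
  have hLr : (0 : ℝ) < L := by exact_mod_cast hL
  set s : ℝ := L * √N with hs
  have hs0 : 0 < s := by positivity
  have hs2 : s ^ 2 = L ^ 2 * N := by rw [hs, mul_pow, Real.sq_sqrt hNr.le]
  let point : (Fin N → ℤ) × (Fin N → ℤ) → EuclideanSpace 𝕂 (Fin N) := fun q =>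
    WithLp.toLp 2 fun i =>
      (((q.1 i : ℝ) / s : ℝ) : 𝕂) + (((q.2 i : ℝ) / s : ℝ) : 𝕂) * RCLike.I
  have mem_F : ∀ (u : Fin N → ℝ) (a : Fin N → ℤ), ∑ i, u i ^ 2 ≤ 1 →
      (∀ i, |(a i : ℝ)| ≤ |s * u i|) → a ∈ F := by
    intro u a hu ha
    refine hF a ?_
    have : ∑ i, ((a i).natAbs : ℝ) ≤ L ^ 2 * N := by
      calc ∑ i, ((a i).natAbs : ℝ) ≤ ∑ i, s ^ 2 * u i ^ 2 := by
            refine Finset.sum_le_sum fun i _ => ?_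
            have h1 : (a i).natAbs ≤ (a i).natAbs ^ 2 := Nat.le_self_pow two_ne_zero _
            have h2 : ((a i).natAbs : ℝ) ≤ ((a i).natAbs : ℝ) ^ 2 := by exact_mod_cast h1
            have h3 : ((a i).natAbs : ℝ) = |(a i : ℝ)| := by
              rw [Nat.cast_natAbs, Int.cast_abs]
            have h4 := sq_le_sq.2 (ha i)
            rw [h3, sq_abs] at h2
            rw [h3, ← mul_pow]
            exact h2.trans h4
        _ ≤ L ^ 2 * N := by
            rw [← Finset.mul_sum, hs2]
            exact mul_le_of_le_one_right (by positivity) hu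
    exact_mod_cast this
  refine ⟨((F ×ˢ F).image point).filter fun y => ‖y‖ ≤ 1, ?_, fun y hy =>
    (Finset.mem_filter.1 hy).2, fun x hx => ?_⟩
  · calc (_ : ℝ) ≤ ((F ×ˢ F).card : ℝ) := by
          exact_mod_cast (Finset.card_filter_le _ _).trans Finset.card_image_le
      _ ≤ K ^ N * K ^ N := by
          rw [Finset.card_product, Nat.cast_mul]
          gcongr
      _ = (K ^ 2) ^ N := by ring
  · have hx2 : ∑ i, ‖x i‖ ^ 2 ≤ 1 := by
      rw [← EuclideanSpace.norm_sq_eq]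
      exact pow_le_one₀ (norm_nonneg _) hx
    choose a ha ha' using fun i => Int.exists_abs_le_abs_sub_le (s * RCLike.re (x i))
    choose b hb hb' using fun i => Int.exists_abs_le_abs_sub_le (s * RCLike.im (x i))
    have haF : a ∈ F := by
      refine mem_F _ a (le_trans (Finset.sum_le_sum fun i _ => ?_) hx2) ha
      exact sq_le_sq.2 ((RCLike.abs_re_le_norm _).trans (le_abs_self _))
    have hbF : b ∈ F := by
      refine mem_F _ b (le_trans (Finset.sum_le_sum fun i _ => ?_) hx2) hb
      exact sq_le_sq.2 ((RCLike.abs_im_le_norm _).trans (le_abs_self _))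
    have scale : ∀ (u v : ℝ), |v| ≤ |s * u| → |v / s| ≤ |u| := fun u v h => by
      rw [abs_mul, abs_of_pos hs0] at h
      rwa [abs_div, abs_of_pos hs0, div_le_iff₀ hs0, mul_comm]
    have scale' : ∀ (u v : ℝ), |s * u - v| ≤ 1 → |u - v / s| ≤ 1 / s := fun u v h => by
      rw [le_div_iff₀ hs0]
      calc |u - v / s| * s = |(u - v / s) * s| := by rw [abs_mul, abs_of_pos hs0]
        _ = |s * u - v| := by congr 1; field_simp
        _ ≤ 1 := h
    have hI := norm_I_le_one 𝕂
    refine ⟨point (a, b), Finset.mem_filter.2 ⟨Finset.mem_image_of_mem _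
      (Finset.mem_product.2 ⟨haF, hbF⟩), ?_⟩, ?_⟩
    · refine le_trans ?_ hx
      rw [EuclideanSpace.norm_eq, EuclideanSpace.norm_eq]
      refine Real.sqrt_le_sqrt (Finset.sum_le_sum fun i _ => ?_)
      rw [← RCLike.normSq_eq_def', ← RCLike.normSq_eq_def', RCLike.normSq_apply,
        RCLike.normSq_apply]
      have h1 := sq_le_sq.2 (scale _ _ (ha i))
      have h2 := sq_le_sq.2 (scale _ _ (hb i))
      have h3 : (RCLike.im (RCLike.I : 𝕂)) ^ 2 ≤ 1 := by
        rw [sq_le_one_iff_abs_le_one]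
        exact (RCLike.abs_im_le_norm _).trans hI
      have h4 : ((b i : ℝ) / s) ^ 2 * (RCLike.im (RCLike.I : 𝕂)) ^ 2 ≤ ((b i : ℝ) / s) ^ 2 :=
        mul_le_of_le_one_right (sq_nonneg _) h3
      simp only [point, map_add, RCLike.ofReal_re, RCLike.ofReal_im, RCLike.re_ofReal_mul,
        RCLike.im_ofReal_mul, RCLike.I_re]
      nlinarith
    · have hcoord : ∀ i, ‖(x - point (a, b)) i‖ ^ 2 ≤ (2 / s) ^ 2 := fun i => by
        have : (x - point (a, b)) i = ((RCLike.re (x i) - (a i : ℝ) / s : ℝ) : 𝕂)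
            + ((RCLike.im (x i) - (b i : ℝ) / s : ℝ) : 𝕂) * RCLike.I := by
          rw [PiLp.sub_apply]
          nth_rewrite 1 [← RCLike.re_add_im (x i)]
          simp only [point]
          push_cast
          ring
        rw [this]
        gcongr
        refine (norm_add_le _ _).trans ?_
        rw [norm_mul, RCLike.norm_ofReal, RCLike.norm_ofReal]
        have h1 := scale' _ _ (ha' i)
        have h2 := scale' _ _ (hb' i)
        have h3 := mul_le_of_le_one_right (abs_nonneg (RCLike.im (x i) - (b i : ℝ) / s)) hI
        have : 2 / s = 1 / s + 1 / s := by ring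
        linarith
      rw [EuclideanSpace.norm_eq]
      refine Real.sqrt_le_iff.2 ⟨by positivity, ?_⟩
      calc _ ≤ ∑ _i : Fin N, (2 / s) ^ 2 := Finset.sum_le_sum fun i _ => hcoord i
        _ = (2 / L) ^ 2 := by
          rw [Finset.sum_const, Finset.card_univ, Fintype.card_fin, nsmul_eq_mul, div_pow, hs2]
          field_simp

/-- The multilinear form on Euclidean spaces with coefficients `ε`. -/
noncomputable def euclideanForm (𝕂 : Type*) [RCLike 𝕂] {m N : ℕ} (ε : (Fin m → Fin N) → 𝕂) :
    ContinuousMultilinearMap 𝕂 (fun _ : Fin m => EuclideanSpace 𝕂 (Fin N)) 𝕂 :=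
  ∑ i : Fin m → Fin N, ε i •
    (ContinuousMultilinearMap.mkPiAlgebra 𝕂 (Fin m) 𝕂).compContinuousLinearMap
      fun k => EuclideanSpace.proj (i k)

theorem euclideanForm_apply {𝕂 : Type*} [RCLike 𝕂] {m N : ℕ} (ε : (Fin m → Fin N) → 𝕂)
    (x : Fin m → EuclideanSpace 𝕂 (Fin N)) :
    euclideanForm 𝕂 ε x = ∑ i, ε i * ∏ k, x k (i k) := by
  simp [euclideanForm]

theorem ContinuousMultilinearMap.opNorm_le_of_unit_ball {𝕂 : Type*} [RCLike 𝕂] {ι : Type*}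
    [Fintype ι] {E : ι → Type*} [∀ i, NormedAddCommGroup (E i)] [∀ i, NormedSpace 𝕂 (E i)]
    {G : Type*} [NormedAddCommGroup G] [NormedSpace 𝕂 G]
    (f : ContinuousMultilinearMap 𝕂 E G) {C : ℝ} (hC : 0 ≤ C)
    (h : ∀ x : ∀ i, E i, (∀ i, ‖x i‖ ≤ 1) → ‖f x‖ ≤ C) : ‖f‖ ≤ C := by
  refine f.opNorm_le_bound hC fun x => ?_
  have hx : x = fun i => ((‖x i‖ : ℝ) : 𝕂) • (((‖x i‖⁻¹ : ℝ) : 𝕂) • x i) := by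
    funext i
    by_cases h0 : x i = 0
    · simp [h0]
    · rw [smul_smul, ← RCLike.ofReal_mul, mul_inv_cancel₀ (norm_ne_zero_iff.2 h0)]
      simp
  have hu : ‖f fun i => ((‖x i‖⁻¹ : ℝ) : 𝕂) • x i‖ ≤ C := by
    refine h _ fun i => ?_
    rw [norm_smul, RCLike.norm_ofReal, abs_inv, abs_norm]
    exact inv_mul_le_one
  conv_lhs => rw [hx, f.map_smul_univ]
  rw [norm_smul, norm_prod, mul_comm]
  simp only [RCLike.norm_ofReal, abs_norm]
  gcongr

/-- The norm of a multilinear form is controlled by its values on a sufficiently fine net. -/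
theorem ContinuousMultilinearMap.opNorm_le_of_net {𝕂 : Type*} [RCLike 𝕂] {m : ℕ}
    {E : Type*} [NormedAddCommGroup E] [NormedSpace 𝕂 E]
    (f : ContinuousMultilinearMap 𝕂 (fun _ : Fin m => E) 𝕂) {Y : Set E}
    {δ : ℝ} (hδ : 0 ≤ δ) (hmδ : m * δ ≤ 1 / 2)
    (hY : ∀ y ∈ Y, ‖y‖ ≤ 1) (hnet : ∀ x : E, ‖x‖ ≤ 1 → ∃ y ∈ Y, ‖x - y‖ ≤ δ)
    {B : ℝ} (hB : 0 ≤ B) (h : ∀ y : Fin m → E, (∀ k, y k ∈ Y) → ‖f y‖ ≤ B) :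
    ‖f‖ ≤ 2 * B := by
  suffices ‖f‖ ≤ B + ‖f‖ / 2 by linarith
  refine f.opNorm_le_of_unit_ball (by positivity) fun x hx => ?_
  choose y hyY hxy using fun k => hnet (x k) (hx k)
  have hmax : max ‖x‖ ‖y‖ ≤ 1 :=
    max_le ((pi_norm_le_iff_of_nonneg zero_le_one).2 hx)
      ((pi_norm_le_iff_of_nonneg zero_le_one).2 fun k => hY _ (hyY k))
  have hsub : ‖x - y‖ ≤ δ := (pi_norm_le_iff_of_nonneg hδ).2 hxy
  have h1 := f.norm_image_sub_le x y
  rw [Fintype.card_fin] at h1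
  have h2 : ‖f x - f y‖ ≤ ‖f‖ / 2 := by
    calc _ ≤ _ := h1
      _ ≤ ‖f‖ * m * 1 * δ := by
        gcongr
        exact pow_le_one₀ ((norm_nonneg x).trans (le_max_left _ _)) hmax
      _ = ‖f‖ * (m * δ) := by ring
      _ ≤ ‖f‖ * (1 / 2) := by gcongr
      _ = ‖f‖ / 2 := by ring
  calc ‖f x‖ = ‖f y + (f x - f y)‖ := by congr 1; ring
    _ ≤ ‖f y‖ + ‖f x - f y‖ := norm_add_le _ _
    _ ≤ B + ‖f‖ / 2 := add_le_add (h y hyY) h2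

theorem sum_norm_prod_sq {𝕂 : Type*} [RCLike 𝕂] {m N : ℕ}
    (x : Fin m → EuclideanSpace 𝕂 (Fin N)) :
    ∑ i : Fin m → Fin N, ‖∏ k, x k (i k)‖ ^ 2 = ∏ k, ‖x k‖ ^ 2 := by
  simp_rw [EuclideanSpace.norm_sq_eq, norm_prod, ← Finset.prod_pow]
  exact (Fintype.prod_sum fun k j => ‖x k j‖ ^ 2).symm

/-- Random signs: the Euclidean case of the Kahane–Salem–Zygmund inequality. -/
theorem exists_signs_norm_euclideanForm_le (𝕂 : Type*) [RCLike 𝕂] (m : ℕ) (hm : 1 ≤ m) :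
    ∃ C : ℝ, 0 < C ∧ ∀ N : ℕ, 0 < N → ∃ ε : (Fin m → Fin N) → 𝕂,
      (∀ i, ε i = 1 ∨ ε i = -1) ∧ ‖euclideanForm 𝕂 ε‖ ≤ C * √N := by
  obtain ⟨K, hK, H⟩ := exists_euclidean_net 𝕂 (4 * m) (by omega)
  have hlogK := Real.log_nonneg hK
  set D : ℝ := Real.log 4 + m * Real.log K + 1 / 2 with hD
  have hlog4 : 0 < Real.log 4 := Real.log_pos (by norm_num)
  have hD0 : 0 < D := by positivity
  refine ⟨2 * (2 * D), by positivity, fun N hN => ?_⟩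
  obtain ⟨Y, hYcard, hY1, hYnet⟩ := H N hN
  have hN1 : (1 : ℝ) ≤ N := by exact_mod_cast hN
  have hsqrt : 0 < √(N : ℝ) := Real.sqrt_pos.2 (by linarith)
  let S : Finset ((Fin m → EuclideanSpace 𝕂 (Fin N)) × Bool) :=
    (Fintype.piFinset fun _ => Y) ×ˢ Finset.univ
  let c : (Fin m → EuclideanSpace 𝕂 (Fin N)) × Bool → (Fin m → Fin N) → ℝ := fun q i =>
    if q.2 then RCLike.re (∏ k, q.1 k (i k)) else RCLike.im (∏ k, q.1 k (i k))
  have hScard : (S.card : ℝ) ≤ 2 * (K ^ N) ^ m := by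
    simp only [S, Finset.card_product, Fintype.card_piFinset, Finset.prod_const, Finset.card_univ,
      Fintype.card_fin, Fintype.card_bool]
    push_cast
    rw [mul_comm]
    gcongr
  have hc : ∀ q ∈ S, ∑ i, c q i ^ 2 ≤ 1 := by
    rintro ⟨y, b⟩ hq
    have hy := Fintype.mem_piFinset.1 (Finset.mem_product.1 hq).1
    calc ∑ i, c (y, b) i ^ 2 ≤ ∑ i : Fin m → Fin N, ‖∏ k, y k (i k)‖ ^ 2 := by
          refine Finset.sum_le_sum fun i _ => sq_le_sq.2 ?_
          rw [abs_norm]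
          cases b
          · simpa only [c, Bool.false_eq_true, if_false] using RCLike.abs_im_le_norm _
          · simpa only [c, if_true] using RCLike.abs_re_le_norm _
      _ = ∏ k, ‖y k‖ ^ 2 := sum_norm_prod_sq y
      _ ≤ 1 := Finset.prod_le_one (fun k _ => by positivity) fun k _ =>
          pow_le_one₀ (norm_nonneg _) (hY1 _ (hy k))
  obtain ⟨e, he⟩ := exists_signs_forall_exp_le S c hc √N
  have hsmall : ∀ q ∈ S, |∑ i, ((e i : ℤ) : ℝ) * c q i| ≤ D * √N := by
    intro q hq
    have h1 : Real.exp (√N * |∑ i, ((e i : ℤ) : ℝ) * c q i|)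
        ≤ 4 * (K ^ N) ^ m * Real.exp (N / 2) := by
      refine (he q hq).trans ?_
      rw [Real.sq_sqrt (by positivity)]
      have := Real.exp_pos ((N : ℝ) / 2)
      nlinarith
    have hK0 : 0 < K := by linarith
    have h2 := Real.log_le_log (Real.exp_pos _) h1
    rw [Real.log_exp, Real.log_mul (by positivity) (by positivity),
      Real.log_mul (by positivity) (by positivity), Real.log_exp, Real.log_pow, Real.log_pow] at h2
    have h3 : √N * |∑ i, ((e i : ℤ) : ℝ) * c q i| ≤ √N * (D * √N) := by
      calc _ ≤ _ := h2
        _ ≤ D * N := by rw [hD]; nlinarith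
        _ = √N * (D * √N) := by
          rw [mul_left_comm, Real.mul_self_sqrt (by positivity)]
    exact le_of_mul_le_mul_left h3 hsqrt
  refine ⟨fun i => ((e i : ℤ) : 𝕂), fun i => ?_, ?_⟩
  · rcases Int.units_eq_one_or (e i) with h | h <;> simp [h]
  · have hm0 : (0 : ℝ) < m := by exact_mod_cast hm
    rw [mul_assoc]
    refine ContinuousMultilinearMap.opNorm_le_of_net (Y := Y) _
      (δ := 2 / ((4 * m : ℕ) : ℝ)) (by positivity) ?_ hY1 hYnet (by positivity) fun y hy => ?_
    · push_cast
      apply le_of_eq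
      field_simp
      norm_num
    · rw [euclideanForm_apply]
      have hyS : ∀ b, (y, b) ∈ S := fun b =>
        Finset.mem_product.2 ⟨Fintype.mem_piFinset.2 hy, Finset.mem_univ _⟩
      have hre := hsmall _ (hyS true)
      have him := hsmall _ (hyS false)
      refine (norm_le_abs_re_add_abs_im _).trans ?_
      have cast : ∀ i, (((e i : ℤ) : 𝕂)) = (((e i : ℤ) : ℝ) : 𝕂) := fun i => by simp
      simp only [cast, map_sum, RCLike.re_ofReal_mul, RCLike.im_ofReal_mul]
      simp only [c, if_true, Bool.false_eq_true, if_false] at hre him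
      linarith

theorem norm_toLp_le_of_lpNormE_le_one {𝕂 : Type*} [RCLike 𝕂] {p : ℝ≥0∞} (hp : 1 ≤ p) {N : ℕ}
    (hN : 0 < N) (x : Fin N → 𝕂) (hx : lpNormE 𝕂 p x ≤ 1) :
    ‖(WithLp.toLp 2 x : EuclideanSpace 𝕂 (Fin N))‖ ≤ (N : ℝ) ^ kszAlpha p := by
  have hN0 : (0 : ℝ) < N := by exact_mod_cast hN
  rw [EuclideanSpace.norm_eq]
  change √(∑ i, ‖x i‖ ^ 2) ≤ _
  suffices ∑ i, ‖x i‖ ^ 2 ≤ (N : ℝ) ^ (2 * kszAlpha p) by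
    refine Real.sqrt_le_iff.2 ⟨by positivity, this.trans_eq ?_⟩
    rw [← Real.rpow_natCast, ← Real.rpow_mul hN0.le]
    congr 1
    push_cast
    ring
  by_cases htop : p = ∞
  · subst htop
    simp only [lpNormE, if_true] at hx
    have h1 : ∀ i, ‖x i‖ ≤ 1 := fun i =>
      (le_ciSup (f := fun i => ‖x i‖) (Set.finite_range _).bddAbove i).trans hx
    have hα : 2 * kszAlpha ∞ = 1 := by simp [kszAlpha]
    rw [hα, Real.rpow_one]
    calc ∑ i, ‖x i‖ ^ 2 ≤ ∑ _i : Fin N, (1 : ℝ) :=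
          Finset.sum_le_sum fun i _ => pow_le_one₀ (norm_nonneg _) (h1 i)
      _ = N := by simp
  · simp only [lpNormE, if_neg htop] at hx
    set r := p.toReal with hr
    have hr1 : 1 ≤ r := by
      rw [hr, ← ENNReal.toReal_one]
      exact ENNReal.toReal_mono htop hp
    have hr0 : 0 < r := by linarith
    have hnonneg : 0 ≤ ∑ i, ‖x i‖ ^ r := Finset.sum_nonneg fun i _ => by positivity
    have hsum : ∑ i, ‖x i‖ ^ r ≤ 1 := by
      by_contra! hlt
      exact absurd hx (not_le.2 (Real.one_lt_rpow hlt (by positivity)))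
    by_cases h2 : 2 ≤ p
    · have hr2 : 2 ≤ r := by
        have := ENNReal.toReal_mono htop h2
        simpa using this
      have hmean := Real.rpow_sum_le_const_mul_sum_rpow_of_nonneg (s := Finset.univ)
        (f := fun i => ‖x i‖ ^ 2) (p := r / 2) (by linarith) fun i _ => by positivity
      have hpow : ∀ i, (‖x i‖ ^ 2) ^ (r / 2) = ‖x i‖ ^ r := fun i => by
        rw [← Real.rpow_natCast, ← Real.rpow_mul (norm_nonneg _)]
        congr 1
        push_cast
        ring
      simp only [hpow, Finset.card_univ, Fintype.card_fin] at hmean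
      have hle : (∑ i, ‖x i‖ ^ 2) ^ (r / 2) ≤ ((N : ℝ) ^ (2 * kszAlpha p)) ^ (r / 2) := by
        refine hmean.trans ((mul_le_of_le_one_right (by positivity) hsum).trans_eq ?_)
        rw [← Real.rpow_mul hN0.le]
        congr 1
        rw [kszAlpha, if_pos h2, ← hr]
        field_simp
      exact (Real.rpow_le_rpow_iff (Finset.sum_nonneg fun i _ => by positivity) (by positivity)
        (by linarith)).1 hle
    · have hr2 : r ≤ 2 := by
        have := ENNReal.toReal_mono (by simp) (not_le.1 h2).le
        simpa using this
      rw [kszAlpha, if_neg h2, mul_zero, Real.rpow_zero]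
      refine le_trans (Finset.sum_le_sum fun i _ => ?_) hsum
      have h1 : ‖x i‖ ≤ 1 := by
        by_contra! hlt
        have := (Finset.single_le_sum (f := fun i => ‖x i‖ ^ r) (fun i _ => by positivity)
          (Finset.mem_univ i)).trans hsum
        exact absurd this (not_le.2 (Real.one_lt_rpow hlt hr0))
      rw [← Real.rpow_natCast]
      exact Real.rpow_le_rpow_of_exponent_ge_of_imp (norm_nonneg _) h1 (by exact_mod_cast hr2)
        fun _ h => absurd h (by norm_num)

theorem kahane_salem_zygmund_extended
    (𝕂 : Type*) [RCLike 𝕂] (m : ℕ) (hm : 1 ≤ m)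
    (p : Fin m → ℝ≥0∞) (hp : ∀ k, 1 ≤ p k) :
    ∃ C : ℝ, 0 < C ∧ ∀ N : ℕ, 0 < N →
      ∃ ε : (Fin m → Fin N) → 𝕂, (∀ i, ε i = 1 ∨ ε i = -1) ∧
        multilinearNormE 𝕂 p
          (∑ i : Fin m → Fin N, ε i •
            (MultilinearMap.mkPiRing 𝕂 (Fin m) (1 : 𝕂)).compLinearMap
              (fun k => LinearMap.proj (i k)))
          ≤ C * (N : ℝ) ^ ((1 : ℝ) / 2 + ∑ k, kszAlpha (p k)) := by
  obtain ⟨C, hC, H⟩ := exists_signs_norm_euclideanForm_le 𝕂 m hm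
  refine ⟨C, hC, fun N hN => ?_⟩
  obtain ⟨ε, hε, hnorm⟩ := H N hN
  have hN0 : (0 : ℝ) < N := by exact_mod_cast hN
  refine ⟨ε, hε, Real.sSup_le ?_ (by positivity)⟩
  rintro t ⟨x, hx, rfl⟩
  have happly : (∑ i : Fin m → Fin N, ε i •
      (MultilinearMap.mkPiRing 𝕂 (Fin m) (1 : 𝕂)).compLinearMap
        (fun k => LinearMap.proj (i k))) x = euclideanForm 𝕂 ε fun k => WithLp.toLp 2 (x k) := by
    rw [euclideanForm_apply]
    simp
  rw [happly, Real.rpow_add hN0, ← Real.sqrt_eq_rpow, Real.rpow_sum_of_pos hN0, ← mul_assoc]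
  refine ((euclideanForm 𝕂 ε).le_opNorm _).trans ?_
  gcongr with k
  exact norm_toLp_le_of_lpNormE_le_one (hp k) hN (x k) (hx k)
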